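/- arXiv:2602.23360 — 9 statements merged into one kernel-verified Lean document; each statement's English description precedes it below -/
import Mathlib

section
/- Let H be a real inner product space, y ∈ H, and let A, B ⊆ H be classes of predictors such that for every f₁, f₂ ∈ A the midpoint (1/2)(f₁ + f₂) lies in B. Fix ε ≥ 0 and suppose f₁, f₂ ∈ A satisfy ‖y − fᵢ‖² ≤ inf_{f∈A} ‖y − f‖² + ε for i ∈ {1,2}. Then ‖f₁ − f₂‖² ≤ 4(inf_{f∈A} ‖y − f‖² − inf_{f∈B} ‖y − f‖² + ε). -/
/-- Local learning-curve bound from midpoint closure: if midpoints of pairs from `A`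
lie in `B`, and `f₁, f₂ ∈ A` are `ε`-optimal in `A`, then
`D(f₁,f₂) ≤ 4 (R(A) − R(B) + ε)` where `R(S) = inf_{f ∈ S} ‖y − f‖²`. -/
theorem local_learning_curve_bound
    {H : Type*} [NormedAddCommGroup H] [InnerProductSpace ℝ H]
    (y : H) (A B : Set H)
    (hmid : ∀ f₁ ∈ A, ∀ f₂ ∈ A, (1 / 2 : ℝ) • (f₁ + f₂) ∈ B)
    (ε : ℝ) (hε : 0 ≤ ε)
    (f₁ f₂ : H) (hf₁ : f₁ ∈ A) (hf₂ : f₂ ∈ A)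
    (h₁ : ‖y - f₁‖ ^ 2 ≤ sInf ((fun f => ‖y - f‖ ^ 2) '' A) + ε)
    (h₂ : ‖y - f₂‖ ^ 2 ≤ sInf ((fun f => ‖y - f‖ ^ 2) '' A) + ε) :
    ‖f₁ - f₂‖ ^ 2 ≤
      4 * (sInf ((fun f => ‖y - f‖ ^ 2) '' A) - sInf ((fun f => ‖y - f‖ ^ 2) '' B) + ε) := by
  have hB : sInf ((fun f => ‖y - f‖ ^ 2) '' B) ≤ ‖y - (1 / 2 : ℝ) • (f₁ + f₂)‖ ^ 2 := by
    apply csInf_le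
    · refine ⟨0, ?_⟩
      rintro _ ⟨f, _, rfl⟩
      exact sq_nonneg _
    · exact ⟨_, hmid f₁ hf₁ f₂ hf₂, rfl⟩
  have hp := parallelogram_law_with_norm ℝ (y - f₁) (y - f₂)
  have e1 : (y - f₁) + (y - f₂) = (2 : ℝ) • (y - (1 / 2 : ℝ) • (f₁ + f₂)) := by
    module
  have e2 : (y - f₁) - (y - f₂) = -(f₁ - f₂) := by abel
  rw [e1, e2, norm_neg, norm_smul, Real.norm_ofNat] at hp
  nlinarith [hp, hB, h₁, h₂]
end

section
/- Let H be a separable real Hilbert space, y ∈ H, and let Q be a Borel probability measure on H. For a finite tuple G = (g₁, …, g_t) ∈ H^t, let h_G denote the orthogonal projection of y onto the linear span of {g₁, …, g_t}, and let R(G) := ‖y − h_G‖²; assume the maps G ↦ h_G and G ↦ R(G) are measurable on H^t. For t ∈ ℕ, let R̄_t denote the expectation of R(G) over G drawn from the product measure Q^t. Then for G and G′ drawn independently from Q^k, the expected disagreement satisfies E[‖h_G − h_{G′}‖²] ≤ 4(R̄_k − R̄_{2k}), where R̄_{2k} is the expectation of R over the concatenated 2k-tuple (G, G′) ∼ Q^{2k}.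 -/
open MeasureTheory

/-- Agreement for stacked aggregation: base models drawn i.i.d. from `Q` on a separable
real Hilbert space `H`; `h t G` is the orthogonal projection of `y` onto the span of the
tuple `G` (characterized as the risk minimizer over the span); `R̄_t` is the expected
optimal risk over `Q^t`. Then `E[‖h_G − h_{G'}‖²] ≤ 4 (R̄_k − R̄_{2k})`. -/
theorem agreement_for_stacked_aggregation
    {H : Type*} [NormedAddCommGroup H] [InnerProductSpace ℝ H] [CompleteSpace H]
    [SecondCountableTopology H] [MeasurableSpace H] [BorelSpace H]
    (y : H) (Q : Measure H) [IsProbabilityMeasure Q]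
    (h : (t : ℕ) → (Fin t → H) → H)
    (hproj : ∀ (t : ℕ) (G : Fin t → H),
      h t G ∈ Submodule.span ℝ (Set.range G) ∧
        ∀ f ∈ Submodule.span ℝ (Set.range G), ‖y - h t G‖ ≤ ‖y - f‖)
    (hmeas : ∀ t : ℕ, Measurable (h t))
    (hmeasR : ∀ t : ℕ, Measurable fun G : Fin t → H => ‖y - h t G‖ ^ 2)
    (k : ℕ) :
    (∫ p : (Fin k → H) × (Fin k → H), ‖h k p.1 - h k p.2‖ ^ 2
        ∂((Measure.pi fun _ : Fin k => Q).prod (Measure.pi fun _ : Fin k => Q))) ≤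
      4 * ((∫ G, ‖y - h k G‖ ^ 2 ∂(Measure.pi fun _ : Fin k => Q))
            - ∫ G, ‖y - h (2 * k) G‖ ^ 2 ∂(Measure.pi fun _ : Fin (2 * k) => Q)) := by
  classical
  set μ : Measure (Fin k → H) := Measure.pi fun _ : Fin k => Q with hμ
  let e : Fin k ⊕ Fin k ≃ Fin (2 * k) := finSumFinEquiv.trans (finCongr (two_mul k).symm)
  have mp1 := (measurePreserving_sumPiEquivProdPi_symm (fun _ : Fin k ⊕ Fin k => Q))
  have mp2 := measurePreserving_piCongrLeft (fun _ : Fin (2 * k) => Q) e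
  let c : (Fin k → H) × (Fin k → H) → (Fin (2 * k) → H) := fun p =>
    MeasurableEquiv.piCongrLeft (fun _ : Fin (2 * k) => H) e
      ((MeasurableEquiv.sumPiEquivProdPi (fun _ : Fin k ⊕ Fin k => H)).symm p)
  have mpc : MeasurePreserving c (μ.prod μ) (Measure.pi fun _ : Fin (2 * k) => Q) :=
    mp2.comp mp1
  have hcl : ∀ p i, c p (e (Sum.inl i)) = p.1 i := fun p i =>
    Equiv.piCongrLeft_apply_apply (fun _ : Fin (2 * k) => H) e _ (Sum.inl i)
  have hcr : ∀ p i, c p (e (Sum.inr i)) = p.2 i := fun p i =>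
    Equiv.piCongrLeft_apply_apply (fun _ : Fin (2 * k) => H) e _ (Sum.inr i)
  have hbd : ∀ t G, ‖y - h t G‖ ^ 2 ≤ ‖y‖ ^ 2 := fun t G => by
    have := (hproj t G).2 0 (Submodule.zero_mem _)
    rw [sub_zero] at this
    gcongr
  have hint : ∀ t, Integrable (fun G : Fin t → H => ‖y - h t G‖ ^ 2)
      (Measure.pi fun _ : Fin t => Q) := fun t =>
    Integrable.of_bound (hmeasR t).aestronglyMeasurable (‖y‖ ^ 2)
      (Filter.Eventually.of_forall fun G => by
        rw [Real.norm_of_nonneg (by positivity)]; exact hbd t G)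
  have i1 : Integrable (fun p : (Fin k → H) × (Fin k → H) => ‖y - h k p.1‖ ^ 2) (μ.prod μ) :=
    (hint k).comp_fst μ
  have i2 : Integrable (fun p : (Fin k → H) × (Fin k → H) => ‖y - h k p.2‖ ^ 2) (μ.prod μ) :=
    (hint k).comp_snd μ
  have i3 : Integrable (fun p => ‖y - h (2 * k) (c p)‖ ^ 2) (μ.prod μ) :=
    mpc.integrable_comp_of_integrable (hint (2 * k))
  have e1 : ∫ p, ‖y - h k p.1‖ ^ 2 ∂(μ.prod μ) = ∫ G, ‖y - h k G‖ ^ 2 ∂μ := by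
    rw [integral_fun_fst (fun G => ‖y - h k G‖ ^ 2)]; simp
  have e2 : ∫ p, ‖y - h k p.2‖ ^ 2 ∂(μ.prod μ) = ∫ G, ‖y - h k G‖ ^ 2 ∂μ := by
    rw [integral_fun_snd (fun G => ‖y - h k G‖ ^ 2)]; simp
  have e3 : ∫ p, ‖y - h (2 * k) (c p)‖ ^ 2 ∂(μ.prod μ)
      = ∫ G, ‖y - h (2 * k) G‖ ^ 2 ∂(Measure.pi fun _ : Fin (2 * k) => Q) := by
    rw [← mpc.map_eq, integral_map mpc.measurable.aemeasurable]
    exact (hmeasR (2 * k)).aestronglyMeasurable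
  have key : ∀ p : (Fin k → H) × (Fin k → H), ‖h k p.1 - h k p.2‖ ^ 2 ≤
      2 * ‖y - h k p.1‖ ^ 2 + 2 * ‖y - h k p.2‖ ^ 2 - 4 * ‖y - h (2 * k) (c p)‖ ^ 2 := by
    intro p
    have s1 : h k p.1 ∈ Submodule.span ℝ (Set.range (c p)) := by
      refine Submodule.span_mono ?_ (hproj k p.1).1
      rintro _ ⟨i, rfl⟩
      exact ⟨_, hcl p i⟩
    have s2 : h k p.2 ∈ Submodule.span ℝ (Set.range (c p)) := by
      refine Submodule.span_mono ?_ (hproj k p.2).1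
      rintro _ ⟨i, rfl⟩
      exact ⟨_, hcr p i⟩
    have hm := (hproj (2 * k) (c p)).2 ((1 / 2 : ℝ) • (h k p.1 + h k p.2))
      (Submodule.smul_mem _ _ (Submodule.add_mem _ s1 s2))
    have hm2 := pow_le_pow_left₀ (norm_nonneg _) hm 2
    have hpar := parallelogram_law_with_norm ℝ (y - h k p.1) (y - h k p.2)
    have ha : (y - h k p.1) + (y - h k p.2)
        = (2 : ℝ) • (y - (1 / 2 : ℝ) • (h k p.1 + h k p.2)) := by module
    have hb : ‖(y - h k p.1) - (y - h k p.2)‖ = ‖h k p.1 - h k p.2‖ := by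
      rw [sub_sub_sub_cancel_left, norm_sub_rev]
    rw [ha, hb, norm_smul, Real.norm_of_nonneg (by norm_num : (0 : ℝ) ≤ 2)] at hpar
    nlinarith
  calc _ ≤ ∫ p, (2 * ‖y - h k p.1‖ ^ 2 + 2 * ‖y - h k p.2‖ ^ 2
        - 4 * ‖y - h (2 * k) (c p)‖ ^ 2) ∂(μ.prod μ) :=
        integral_mono_of_nonneg (Filter.Eventually.of_forall fun p => by positivity)
          (((i1.const_mul 2).add (i2.const_mul 2)).sub (i3.const_mul 4))
          (Filter.Eventually.of_forall key)
    _ = _ := by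
      have i12 : Integrable (fun p : (Fin k → H) × (Fin k → H) =>
          2 * ‖y - h k p.1‖ ^ 2 + 2 * ‖y - h k p.2‖ ^ 2) (μ.prod μ) :=
        (i1.const_mul 2).add (i2.const_mul 2)
      rw [integral_sub i12 (i3.const_mul 4),
        integral_add (i1.const_mul 2) (i2.const_mul 2), integral_const_mul, integral_const_mul,
        integral_const_mul, e1, e2, e3]
      ring
end

section
/- For every integer k ≥ 1 and every ε ∈ (0, 1], there exist an integer m ≥ 1 and σ > 0 with the following property. Let H be any real Hilbert space containing orthonormal vectors e₀, e₁, …, e_m, set y := e₀ and gᵢ := e₀ + σeᵢ for i = 1, …, m, and let Q be the uniform probability distribution on {g₁, …, g_m}. For a tuple G of draws from Q let h_G be the orthogonal projection of y onto the span of the entries of G and R(G) := ‖y − h_G‖², and let R̄_t be the expectation of R over Q^t. Then for G, G′ drawn independently from Q^k, E[‖h_G − h_{G′}‖²] ≥ (4 − ε)(R̄_k − R̄_{2k}). -/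
open MeasureTheory

namespace StackingAux

/-- The sum of `t` orthonormal vectors with signs. -/
lemma norm_sq_sum {ι H : Type*} [Fintype ι] [NormedAddCommGroup H] [InnerProductSpace ℝ H]
    {v : ι → H} (hv : Orthonormal ℝ v) (c : ι → ℝ) :
    ‖∑ i, c i • v i‖ ^ 2 = ∑ i, c i ^ 2 := by
  rw [← real_inner_self_eq_norm_sq, hv.inner_sum]
  simp [pow_two]

lemma risk_lower {H : Type*} [NormedAddCommGroup H] [InnerProductSpace ℝ H] {m t : ℕ}
    {e : Fin (m + 1) → H} (he : Orthonormal ℝ e) {σ : ℝ} (hσ : 0 < σ) (a : Fin t → Fin m)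
    {G : Fin t → H} (hG : ∀ i, G i = e 0 + σ • e (a i).succ)
    {f : H} (hf : f ∈ Submodule.span ℝ (Set.range G)) :
    σ ^ 2 / (t + σ ^ 2) ≤ ‖e 0 - f‖ ^ 2 := by
  classical
  have hite := orthonormal_iff_ite.1 he
  set S : Finset (Fin m) := Finset.univ.image a with hS
  have hcard : (S.card : ℝ) ≤ t := by
    have := Finset.card_image_le (s := Finset.univ) (f := a)
    simp only [Finset.card_univ, Fintype.card_fin] at this
    exact_mod_cast this
  set u : H := σ • e 0 - ∑ j ∈ S, e j.succ with hu
  have h0 : inner ℝ u (e 0) = σ := by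
    rw [hu, inner_sub_left, inner_smul_left, sum_inner]
    simp [hite, he.1 0]
  have hs : ∀ j ∈ S, inner ℝ u (e j.succ) = -1 := by
    intro j hj
    rw [hu, inner_sub_left, inner_smul_left, sum_inner]
    simp [hite, hj, (Fin.succ_ne_zero j).symm]
  have huu : ‖u‖ ^ 2 = σ ^ 2 + S.card := by
    rw [← real_inner_self_eq_norm_sq]
    nth_rewrite 2 [hu]
    rw [inner_sub_right, inner_smul_right, inner_sum, h0, Finset.sum_congr rfl hs]
    simp; ring
  have hperp : inner ℝ u f = 0 := by
    have : Submodule.span ℝ (Set.range G) ≤ LinearMap.ker (innerₛₗ ℝ u) := by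
      rw [Submodule.span_le]
      rintro _ ⟨i, rfl⟩
      have : a i ∈ S := by simp [hS]
      simp only [SetLike.mem_coe, LinearMap.mem_ker, innerₛₗ_apply_apply]
      rw [hG, inner_add_right, inner_smul_right, h0, hs _ this]
      ring
    exact this hf
  have hin : inner ℝ u (e 0 - f) = σ := by rw [inner_sub_right, h0, hperp, sub_zero]
  have hcs := real_inner_le_norm u (e 0 - f)
  rw [hin] at hcs
  have h2 : σ ^ 2 ≤ (σ ^ 2 + S.card) * ‖e 0 - f‖ ^ 2 := by
    rw [← huu, ← mul_pow]
    gcongr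
  have hpos : (0 : ℝ) < t + σ ^ 2 := by positivity
  rw [div_le_iff₀ hpos]
  nlinarith [mul_le_mul_of_nonneg_right hcard (sq_nonneg ‖e 0 - f‖)]

lemma minimizer_eq {H : Type*} [NormedAddCommGroup H] [InnerProductSpace ℝ H] {m t : ℕ}
    {e : Fin (m + 1) → H} (he : Orthonormal ℝ e) {σ : ℝ} (hσ : 0 < σ) (a : Fin t → Fin m)
    (ha : Function.Injective a)
    {G : Fin t → H} (hG : ∀ i, G i = e 0 + σ • e (a i).succ)
    {f : H} (hf : f ∈ Submodule.span ℝ (Set.range G))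
    (hmin : ∀ f' ∈ Submodule.span ℝ (Set.range G), ‖e 0 - f‖ ≤ ‖e 0 - f'‖) :
    f = (1 / (t + σ ^ 2)) • ∑ i, G i := by
  classical
  have hite := orthonormal_iff_ite.1 he
  have hpos : (0 : ℝ) < t + σ ^ 2 := by positivity
  set p : H := (1 / (t + σ ^ 2)) • ∑ i, G i with hp
  have hpm : p ∈ Submodule.span ℝ (Set.range G) :=
    Submodule.smul_mem _ _ (Submodule.sum_mem _ fun i _ => Submodule.subset_span ⟨i, rfl⟩)
  have hGG : ∀ i j, inner ℝ (G i) (G j) = 1 + if i = j then σ ^ 2 else 0 := by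
    intro i j
    rw [hG, hG]
    simp only [inner_add_left, inner_add_right, inner_smul_left, inner_smul_right, hite]
    by_cases h : i = j
    · simp [h, (Fin.succ_ne_zero _).symm]; ring
    · simp [h, (Fin.succ_ne_zero _).symm, ha.eq_iff]
  have h0G : ∀ j, inner ℝ (e 0) (G j) = 1 := by
    intro j
    rw [hG]
    simp [inner_add_right, inner_smul_right, hite, he.1 0, (Fin.succ_ne_zero _).symm]
  have hperp : ∀ f' ∈ Submodule.span ℝ (Set.range G), inner ℝ (e 0 - p) f' = 0 := by
    intro f' hf'
    have : Submodule.span ℝ (Set.range G) ≤ LinearMap.ker (innerₛₗ ℝ (e 0 - p)) := by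
      rw [Submodule.span_le]
      rintro _ ⟨i, rfl⟩
      simp only [SetLike.mem_coe, LinearMap.mem_ker, innerₛₗ_apply_apply]
      rw [inner_sub_left, h0G, hp, inner_smul_left, sum_inner]
      simp only [hGG, Finset.sum_add_distrib]
      simp
      field_simp
      ring
    exact this hf'
  have hle := hmin p hpm
  have hpy : ‖e 0 - f‖ ^ 2 = ‖e 0 - p‖ ^ 2 + ‖p - f‖ ^ 2 := by
    have : e 0 - f = (e 0 - p) + (p - f) := by abel
    rw [this, norm_add_sq_real, hperp _ (Submodule.sub_mem _ hpm hf)]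
    ring
  have hle2 : ‖e 0 - f‖ ^ 2 ≤ ‖e 0 - p‖ ^ 2 := by gcongr
  have : ‖p - f‖ ^ 2 = 0 := le_antisymm (by linarith) (sq_nonneg _)
  have : p - f = 0 := by simpa using this
  exact (sub_eq_zero.1 this).symm

lemma risk_upper_inj {H : Type*} [NormedAddCommGroup H] [InnerProductSpace ℝ H] {m t : ℕ}
    {e : Fin (m + 1) → H} (he : Orthonormal ℝ e) {σ : ℝ} (hσ : 0 < σ) (a : Fin t → Fin m)
    (ha : Function.Injective a)
    {G : Fin t → H} (hG : ∀ i, G i = e 0 + σ • e (a i).succ) :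
    ‖e 0 - (1 / (t + σ ^ 2)) • ∑ i, G i‖ ^ 2 = σ ^ 2 / (t + σ ^ 2) := by
  have hpos : (0 : ℝ) < t + σ ^ 2 := by positivity
  let c : Option (Fin t) → ℝ := fun o => o.elim (σ ^ 2 / (t + σ ^ 2)) fun _ => -(σ / (t + σ ^ 2))
  let b : Option (Fin t) → Fin (m + 1) := fun o => o.elim 0 fun i => (a i).succ
  have hb : Function.Injective b := by
    rintro (_ | i) (_ | j) h
    · rfl
    · exact absurd h (Fin.succ_ne_zero _).symm
    · exact absurd h (Fin.succ_ne_zero _)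
    · exact congrArg some (ha (Fin.succ_injective _ h))
  have key : e 0 - (1 / (t + σ ^ 2)) • ∑ i, G i = ∑ o, c o • (e ∘ b) o := by
    rw [Fintype.sum_option]
    simp only [hG, Finset.sum_add_distrib, c, b, Option.elim, Function.comp, ← Finset.smul_sum]
    simp only [Finset.sum_const, Finset.card_univ, Fintype.card_fin, ← Nat.cast_smul_eq_nsmul ℝ]
    match_scalars
    · field_simp; ring
    · field_simp
  rw [key, norm_sq_sum (he.comp b hb), Fintype.sum_option]
  simp only [c, Option.elim, Finset.sum_const, Finset.card_univ, Fintype.card_fin, nsmul_eq_mul]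
  field_simp
  ring

lemma dist_eq {H : Type*} [NormedAddCommGroup H] [InnerProductSpace ℝ H] {m t : ℕ}
    {e : Fin (m + 1) → H} (he : Orthonormal ℝ e) {σ : ℝ} (hσ : 0 < σ) (a b : Fin t → Fin m)
    (hab : Function.Injective (Sum.elim a b))
    {G G' : Fin t → H} (hG : ∀ i, G i = e 0 + σ • e (a i).succ)
    (hG' : ∀ i, G' i = e 0 + σ • e (b i).succ) :
    ‖(1 / (t + σ ^ 2)) • ∑ i, G i - (1 / (t + σ ^ 2)) • ∑ i, G' i‖ ^ 2
      = 2 * σ ^ 2 * t / (t + σ ^ 2) ^ 2 := by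
  have hpos : (0 : ℝ) < t + σ ^ 2 := by positivity
  let c : Fin t ⊕ Fin t → ℝ := Sum.elim (fun _ => σ / (t + σ ^ 2)) fun _ => -(σ / (t + σ ^ 2))
  have key : (1 / (t + σ ^ 2)) • ∑ i, G i - (1 / (t + σ ^ 2)) • ∑ i, G' i
      = ∑ o, c o • (e ∘ (Fin.succ ∘ Sum.elim a b)) o := by
    rw [Fintype.sum_sum_type]
    simp only [hG, hG', Finset.sum_add_distrib, c, Sum.elim_inl, Sum.elim_inr, Function.comp,
      ← Finset.smul_sum]
    module
  rw [key, norm_sq_sum (he.comp _ ((Fin.succ_injective _).comp hab)), Fintype.sum_sum_type]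
  simp only [c, Sum.elim_inl, Sum.elim_inr, Finset.sum_const, Finset.card_univ, Fintype.card_fin,
    nsmul_eq_mul]
  field_simp
  ring

lemma card_inj (ι : Type*) [Fintype ι] [DecidableEq ι] (m : ℕ) :
    Fintype.card {a : ι → Fin m // Function.Injective a} = m.descFactorial (Fintype.card ι) := by
  rw [Fintype.card_congr (Equiv.subtypeInjectiveEquivEmbedding ι (Fin m)),
    Fintype.card_embedding_eq]
  simp

lemma desc_bound (m t : ℕ) (hm : 1 ≤ m) (ht : t ≤ m) :
    1 - (t : ℝ) ^ 2 / m ≤ (m.descFactorial t : ℝ) * (1 / m) ^ t := by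
  have hm0 : (0 : ℝ) < m := by exact_mod_cast hm
  have htm : (t : ℝ) ≤ m := by exact_mod_cast ht
  have h1 : ((m : ℝ) - t) ^ t ≤ m.descFactorial t := by
    have h := Nat.pow_sub_le_descFactorial m t
    have h' : (m - t) ^ t ≤ m.descFactorial t :=
      le_trans (Nat.pow_le_pow_left (by omega) t) h
    have : (((m - t : ℕ) : ℝ)) ^ t ≤ m.descFactorial t := by exact_mod_cast h'
    rwa [Nat.cast_sub ht] at this
  have h2 := one_add_mul_le_pow (a := -((t : ℝ) / m)) (by
    have : (t : ℝ) / m ≤ 1 := by rw [div_le_one hm0]; exact htm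
    linarith) t
  have h3 : (1 + -((t : ℝ) / m)) ^ t = ((m : ℝ) - t) ^ t * (1 / m) ^ t := by
    rw [← mul_pow]; congr 1; field_simp; ring
  calc 1 - (t : ℝ) ^ 2 / m = 1 + t * -((t : ℝ) / m) := by ring
    _ ≤ _ := h2
    _ = _ := h3
    _ ≤ _ := by gcongr

/-- uniform measure on `Fin m` -/
noncomputable def U (m : ℕ) : Measure (Fin m) := ((m : ENNReal))⁻¹ • Measure.count

lemma U_singleton (m : ℕ) (i : Fin m) : U m {i} = (m : ENNReal)⁻¹ := by
  simp [U]

lemma U_prob (m : ℕ) (hm : 1 ≤ m) : IsProbabilityMeasure (U m) := by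
  constructor
  have : m ≠ 0 := by omega
  simp only [U, Measure.smul_apply, Measure.count_univ, smul_eq_mul]
  simp
  exact ENNReal.inv_mul_cancel (by exact_mod_cast this) (by simp)

lemma map_U {H : Type*} [MeasurableSpace H] (m : ℕ) (g : Fin m → H) :
    (m : ENNReal)⁻¹ • ∑ i : Fin m, Measure.dirac (g i) = (U m).map g := by
  ext s hs
  rw [Measure.map_apply (measurable_of_countable g) hs]
  have hd : MeasurableSet (g ⁻¹' s) := .of_discrete
  simp [U, Measure.count, Measure.dirac_apply', hs, hd]
  rfl

lemma emb {α β : Type*} [Finite α] [MeasurableSpace α] [DiscreteMeasurableSpace α]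
    [MeasurableSpace β] [MeasurableSingletonClass β] {f : α → β} (hf : Function.Injective f) :
    MeasurableEmbedding f where
  injective := hf
  measurable := measurable_of_countable f
  measurableSet_image' := fun {s} _ => ((Set.toFinite s).image f).measurableSet

lemma int_pi {H : Type*} [MeasurableSpace H] [MeasurableSingletonClass H] (m : ℕ) (hm : 1 ≤ m)
    (g : Fin m → H) (hg : Function.Injective g) (t : ℕ) (F : (Fin t → H) → ℝ) :
    ∫ G, F G ∂(Measure.pi fun _ : Fin t => (U m).map g)
      = ∑ a : Fin t → Fin m, (1 / (m : ℝ)) ^ t * F (fun i => g (a i)) := by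
  have := U_prob m hm
  have hgm : Measurable g := measurable_of_countable g
  have : IsProbabilityMeasure ((U m).map g) := Measure.isProbabilityMeasure_map hgm.aemeasurable
  rw [← Measure.pi_map_pi (fun _ => hgm.aemeasurable), MeasurableEmbedding.integral_map
    (emb fun a b h => funext fun i => hg (congrFun h i)), integral_fintype .of_finite]
  refine Finset.sum_congr rfl fun a _ => ?_
  simp [Measure.real, U_singleton]

lemma int_prod {H : Type*} [MeasurableSpace H] [MeasurableSingletonClass H] (m : ℕ) (hm : 1 ≤ m)
    (g : Fin m → H) (hg : Function.Injective g) (t : ℕ) (F : (Fin t → H) × (Fin t → H) → ℝ) :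
    ∫ G, F G ∂((Measure.pi fun _ : Fin t => (U m).map g).prod
        (Measure.pi fun _ : Fin t => (U m).map g))
      = ∑ a : (Fin t → Fin m) × (Fin t → Fin m), (1 / (m : ℝ)) ^ (2 * t) *
        F (fun i => g (a.1 i), fun i => g (a.2 i)) := by
  have := U_prob m hm
  have hgm : Measurable g := measurable_of_countable g
  have : IsProbabilityMeasure ((U m).map g) := Measure.isProbabilityMeasure_map hgm.aemeasurable
  have hinj : Function.Injective (fun (a : Fin t → Fin m) i => g (a i)) :=
    fun a b h => funext fun i => hg (congrFun h i)
  rw [← Measure.pi_map_pi (fun _ => hgm.aemeasurable),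
    Measure.map_prod_map _ _ (measurable_of_countable _) (measurable_of_countable _),
    MeasurableEmbedding.integral_map (emb (hinj.prodMap hinj)), integral_fintype .of_finite]
  refine Finset.sum_congr rfl fun a _ => ?_
  obtain ⟨a, b⟩ := a
  rw [← Set.singleton_prod_singleton, Measure.real, Measure.prod_prod, Measure.pi_singleton,
    Measure.pi_singleton]
  simp [U_singleton, two_mul, pow_add, Prod.map]

lemma final_ineq (k : ℝ) (hk : 1 ≤ k) (ε : ℝ) (hε0 : 0 < ε) (hε1 : ε ≤ 1) (s δ A B D : ℝ)
    (hs : s = ε * k / 4) (hδ0 : 0 ≤ δ)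
    (hδ : 6 * δ ≤ k * (ε * k / 2) / ((k + s) ^ 2 * (2 * k + s)))
    (hA : A ≤ s / (k + s) + δ * s) (hB : s / (2 * k + s) ≤ B)
    (hD : (1 - δ) * (2 * s * k / (k + s) ^ 2) ≤ D) : (4 - ε) * (A - B) ≤ D := by
  have hs0 : 0 < s := by rw [hs]; positivity
  have h1 : (4 - ε) * (A - B) ≤ (4 - ε) * (s / (k + s) + δ * s - s / (2 * k + s)) := by
    apply mul_le_mul_of_nonneg_left <;> linarith
  refine h1.trans (le_trans ?_ hD)
  have hb : 2 * k / (k + s) ^ 2 ≤ 2 := by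
    rw [div_le_iff₀ (by positivity)]; nlinarith
  have hgap : k * (ε * k / 2) / ((k + s) ^ 2 * (2 * k + s)) ≤
      2 * k / (k + s) ^ 2 - (4 - ε) * (1 / (k + s) - 1 / (2 * k + s)) := by
    have : 2 * k / (k + s) ^ 2 - (4 - ε) * (1 / (k + s) - 1 / (2 * k + s))
      = k * (ε * k - 2 * s + ε * s) / ((k + s) ^ 2 * (2 * k + s)) := by
      field_simp; ring
    rw [this]
    gcongr
    nlinarith [mul_pos hε0 hs0]
  have h2 : (4 - ε) * (1 / (k + s) + δ - 1 / (2 * k + s)) ≤ (1 - δ) * (2 * k / (k + s) ^ 2) := by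
    nlinarith [mul_le_mul_of_nonneg_left hb hδ0, mul_nonneg hδ0 hε0.le]
  calc _ = s * ((4 - ε) * (1 / (k + s) + δ - 1 / (2 * k + s))) := by ring
    _ ≤ s * ((1 - δ) * (2 * k / (k + s) ^ 2)) := by gcongr
    _ = _ := by ring

end StackingAux



/-- Near-tightness of the factor 4 for stacking: for every `k ≥ 1` and `ε ∈ (0,1]` there
are `m ≥ 1` and `σ > 0` such that for any real Hilbert space with orthonormal vectors
`e₀, …, e_m`, target `y = e₀`, base models `gᵢ = e₀ + σ eᵢ`, and `Q` uniform on the `gᵢ`,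
the least-squares (orthogonal projection) stacked predictors from two independent draws
from `Q^k` satisfy `E[‖h_G − h_{G'}‖²] ≥ (4 − ε)(R̄_k − R̄_{2k})`. -/
theorem stacking_lower_bound_factor_four
    (k : ℕ) (hk : 1 ≤ k) (ε : ℝ) (hε0 : 0 < ε) (hε1 : ε ≤ 1) :
    ∃ m : ℕ, 1 ≤ m ∧ ∃ σ : ℝ, 0 < σ ∧
      ∀ (H : Type) [inst1 : NormedAddCommGroup H] [inst2 : InnerProductSpace ℝ H]
        [inst3 : CompleteSpace H] [inst4 : MeasurableSpace H] [inst5 : BorelSpace H],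
      ∀ e : Fin (m + 1) → H, Orthonormal ℝ e →
      ∀ g : Fin m → H, (∀ i : Fin m, g i = e 0 + σ • e i.succ) →
      ∀ Q : Measure H, Q = ((m : ENNReal))⁻¹ • ∑ i : Fin m, Measure.dirac (g i) →
      ∀ h : (t : ℕ) → (Fin t → H) → H,
        (∀ (t : ℕ) (G : Fin t → H),
          h t G ∈ Submodule.span ℝ (Set.range G) ∧
            ∀ f ∈ Submodule.span ℝ (Set.range G), ‖e 0 - h t G‖ ≤ ‖e 0 - f‖) →
        (∀ t : ℕ, Measurable (h t)) →
        (4 - ε) * ((∫ G, ‖e 0 - h k G‖ ^ 2 ∂(Measure.pi fun _ : Fin k => Q))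
              - ∫ G, ‖e 0 - h (2 * k) G‖ ^ 2 ∂(Measure.pi fun _ : Fin (2 * k) => Q)) ≤
          ∫ p : (Fin k → H) × (Fin k → H), ‖h k p.1 - h k p.2‖ ^ 2
            ∂((Measure.pi fun _ : Fin k => Q).prod (Measure.pi fun _ : Fin k => Q)) := by
  classical
  have hk' : (1 : ℝ) ≤ k := by exact_mod_cast hk
  set s : ℝ := ε * k / 4 with hs
  have hs0 : 0 < s := by positivity
  set gap : ℝ := k * (ε * k / 2) / ((k + s) ^ 2 * (2 * k + s)) with hgap
  have hgap0 : 0 < gap := by positivity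
  obtain ⟨N, hN⟩ := exists_nat_ge (6 * (2 * (k : ℝ)) ^ 2 / gap)
  refine ⟨N + 2 * k, by omega, Real.sqrt s, Real.sqrt_pos.2 hs0, ?_⟩
  generalize hm : N + 2 * k = m
  intro H _ _ _ _ _ e he g hg Q hQ h hh _
  have hm1 : 1 ≤ m := by omega
  have hm0 : (0 : ℝ) < m := by exact_mod_cast hm1
  have hNm : (N : ℝ) ≤ m := by exact_mod_cast (by omega : N ≤ m)
  set σ := Real.sqrt s with hσdef
  have hσ : 0 < σ := Real.sqrt_pos.2 hs0
  have hσs : σ ^ 2 = s := Real.sq_sqrt hs0.le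
  have hinj : Function.Injective g := by
    intro i j hij
    rw [hg, hg] at hij
    have := smul_right_injective H hσ.ne' (add_left_cancel hij)
    exact Fin.succ_injective _ (he.linearIndependent.injective this)
  rw [StackingAux.map_U] at hQ
  subst hQ
  rw [StackingAux.int_pi m hm1 g hinj, StackingAux.int_pi m hm1 g hinj,
    StackingAux.int_prod m hm1 g hinj]
  set δ : ℝ := (2 * (k : ℝ)) ^ 2 / m with hδ
  have hsum1 : ∀ t : ℕ, ∑ _a : Fin t → Fin m, (1 / (m : ℝ)) ^ t = 1 := by
    intro t
    simp [← mul_pow, hm0.ne']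
  refine StackingAux.final_ineq k hk' ε hε0 hε1 s δ _ _ _ hs (by positivity) ?_ ?_ ?_ ?_
  · rw [← hgap, hδ, ← mul_div_assoc, div_le_iff₀ hm0]
    rw [div_le_iff₀ hgap0] at hN
    nlinarith
  · -- upper bound on the k-risk
    have hpt : ∀ a : Fin k → Fin m, ‖e 0 - h k (fun i => g (a i))‖ ^ 2 ≤
        (s / (k + s) + s) - if Function.Injective a then s else 0 := by
      intro a
      obtain ⟨h1, h2⟩ := hh k (fun i => g (a i))
      by_cases ha : Function.Injective a
      · rw [StackingAux.minimizer_eq he hσ a ha (fun i => hg (a i)) h1 h2,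
          StackingAux.risk_upper_inj he hσ a ha (fun i => hg (a i)), hσs]
        simp [ha]
      · have h3 := h2 (g (a ⟨0, hk⟩)) (Submodule.subset_span ⟨⟨0, hk⟩, rfl⟩)
        have h4 : ‖e 0 - g (a ⟨0, hk⟩)‖ = σ := by
          rw [hg, sub_add_cancel_left, norm_neg, norm_smul, he.1]
          simp [abs_of_pos hσ]
        rw [h4] at h3
        have : ‖e 0 - h k (fun i => g (a i))‖ ^ 2 ≤ σ ^ 2 := by gcongr
        rw [hσs] at this
        have : 0 < s / (k + s) := by positivity
        simp only [ha, if_false]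
        linarith
    have hd := StackingAux.desc_bound m k hm1 (by omega)
    have hδ' : (k : ℝ) ^ 2 / m ≤ δ := by
      rw [hδ]; gcongr; linarith
    have hc : ∑ a : Fin k → Fin m, (1 / (m : ℝ)) ^ k * (if Function.Injective a then s else 0)
        = (m.descFactorial k : ℝ) * (1 / m) ^ k * s := by
      have := StackingAux.card_inj (Fin k) m
      rw [Fintype.card_subtype, Fintype.card_fin] at this
      rw [← this]
      simp only [mul_ite, mul_zero, ← Finset.sum_filter, Finset.sum_const, nsmul_eq_mul]
      ring
    calc _ ≤ ∑ a : Fin k → Fin m, (1 / (m : ℝ)) ^ k *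
          ((s / (k + s) + s) - if Function.Injective a then s else 0) := by
          gcongr with a; exact hpt a
      _ = (s / (k + s) + s) - (m.descFactorial k : ℝ) * (1 / m) ^ k * s := by
          simp only [mul_sub]
          rw [Finset.sum_sub_distrib, hc, ← Finset.sum_mul, hsum1, one_mul]
      _ ≤ _ := by nlinarith
  · have hpt : ∀ a : Fin (2 * k) → Fin m,
        s / (2 * k + s) ≤ ‖e 0 - h (2 * k) (fun i => g (a i))‖ ^ 2 := by
      intro a
      have := StackingAux.risk_lower he hσ a (fun i => hg (a i)) (hh (2 * k) (fun i => g (a i))).1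
      rw [hσs] at this
      exact_mod_cast this
    calc s / (2 * k + s) = ∑ a : Fin (2 * k) → Fin m, (1 / (m : ℝ)) ^ (2 * k) *
          (s / (2 * k + s)) := by rw [← Finset.sum_mul, hsum1, one_mul]
      _ ≤ _ := by gcongr with a; exact hpt a
  · have hpt : ∀ p : (Fin k → Fin m) × (Fin k → Fin m),
        (if Function.Injective (Sum.elim p.1 p.2) then 2 * s * k / (k + s) ^ 2 else 0) ≤
        ‖h k (fun i => g (p.1 i)) - h k (fun i => g (p.2 i))‖ ^ 2 := by
      rintro ⟨a, b⟩
      split_ifs with hab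
      · have ha : Function.Injective a := hab.comp Sum.inl_injective
        have hb : Function.Injective b := hab.comp Sum.inr_injective
        obtain ⟨h1, h2⟩ := hh k (fun i => g (a i))
        obtain ⟨h3, h4⟩ := hh k (fun i => g (b i))
        simp only
        rw [StackingAux.minimizer_eq he hσ a ha (fun i => hg (a i)) h1 h2,
          StackingAux.minimizer_eq he hσ b hb (fun i => hg (b i)) h3 h4,
          StackingAux.dist_eq he hσ a b hab (fun i => hg (a i)) (fun i => hg (b i)), hσs]
      · positivity
    have hd := StackingAux.desc_bound m (2 * k) hm1 (by omega)
    have hcard : (Finset.univ.filter fun p : (Fin k → Fin m) × (Fin k → Fin m) =>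
        Function.Injective (Sum.elim p.1 p.2)).card = m.descFactorial (2 * k) := by
      have := StackingAux.card_inj (Fin k ⊕ Fin k) m
      rw [Fintype.card_sum, Fintype.card_fin, ← two_mul] at this
      rw [← this, ← Fintype.card_subtype]
      refine Fintype.card_congr ((Equiv.sumArrowEquivProdArrow (Fin k) (Fin k)
        (Fin m)).symm.subtypeEquiv fun p => ?_)
      rfl
    calc _ ≤ (m.descFactorial (2 * k) : ℝ) * (1 / m) ^ (2 * k) * (2 * s * k / (k + s) ^ 2) := by
          gcongr
          rw [hδ]
          exact_mod_cast hd
      _ = ∑ p : (Fin k → Fin m) × (Fin k → Fin m), (1 / (m : ℝ)) ^ (2 * k) *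
          (if Function.Injective (Sum.elim p.1 p.2) then 2 * s * k / (k + s) ^ 2 else 0) := by
          rw [← hcard]
          simp only [mul_ite, mul_zero, ← Finset.sum_filter, Finset.sum_const, nsmul_eq_mul]
          ring
      _ ≤ _ := by gcongr with p; exact hpt p
end

section
/- Let H be a real inner product space containing orthonormal vectors e₀, e₁, …, e_m, let σ > 0, set y := e₀ and gᵢ := e₀ + σeᵢ for i = 1, …, m. For any nonempty subset S ⊆ {1, …, m} with |S| = r, the vector f_S := (1/(r + σ²)) Σ_{i∈S} gᵢ is the unique minimizer of ‖y − f‖² over the linear span of {gᵢ : i ∈ S}, and the minimal value is ‖y − f_S‖² = σ²/(r + σ²). -/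
/-- Closed-form least squares for the lower-bound construction: with orthonormal
`e₀, …, e_m`, target `y = e₀`, and base models `gᵢ = e₀ + σ eᵢ`, for any nonempty
`S ⊆ {1,…,m}` with `|S| = r`, the vector `f_S = (1/(r + σ²)) ∑_{i∈S} gᵢ` is the unique
minimizer of `‖y − f‖²` over the span of `{gᵢ : i ∈ S}`, with value `σ²/(r + σ²)`. -/
theorem closed_form_least_squares
    {H : Type*} [NormedAddCommGroup H] [InnerProductSpace ℝ H]
    (m : ℕ) (e : Fin (m + 1) → H) (he : Orthonormal ℝ e)
    (σ : ℝ) (hσ : 0 < σ)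
    (g : Fin m → H) (hg : ∀ i : Fin m, g i = e 0 + σ • e i.succ)
    (S : Finset (Fin m)) (hS : S.Nonempty)
    (fS : H) (hfS : fS = ((S.card : ℝ) + σ ^ 2)⁻¹ • ∑ i ∈ S, g i) :
    fS ∈ Submodule.span ℝ (g '' (S : Set (Fin m))) ∧
    (∀ f ∈ Submodule.span ℝ (g '' (S : Set (Fin m))), ‖e 0 - fS‖ ^ 2 ≤ ‖e 0 - f‖ ^ 2) ∧
    (∀ f ∈ Submodule.span ℝ (g '' (S : Set (Fin m))),
      ‖e 0 - f‖ ^ 2 = ‖e 0 - fS‖ ^ 2 → f = fS) ∧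
    ‖e 0 - fS‖ ^ 2 = σ ^ 2 / ((S.card : ℝ) + σ ^ 2) := by
  have hD : (0 : ℝ) < (S.card : ℝ) + σ ^ 2 := by positivity
  have hee := orthonormal_iff_ite.mp he
  have h0g : ∀ j, inner ℝ (e 0) (g j) = 1 := by
    intro j
    rw [hg, inner_add_right, inner_smul_right, hee, hee]
    simp [(Fin.succ_ne_zero j).symm]
  have hgg : ∀ i j, inner ℝ (g i) (g j) = 1 + if i = j then σ ^ 2 else 0 := by
    intro i j
    rw [hg i, inner_add_left, h0g, inner_smul_left, hg j, inner_add_right, inner_smul_right,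
      hee, hee]
    by_cases h : i = j
    · simp [h, Fin.succ_ne_zero, sq]
    · simp [h, Fin.succ_ne_zero]
  have horth : ∀ j ∈ S, inner ℝ (e 0 - fS) (g j) = 0 := by
    intro j hj
    rw [inner_sub_left, h0g, hfS, inner_smul_left, sum_inner]
    simp only [hgg, Finset.sum_add_distrib, Finset.sum_ite_eq', hj, if_true]
    simp
    field_simp
    ring
  have hspan : ∀ f ∈ Submodule.span ℝ (g '' (S : Set (Fin m))), inner ℝ (e 0 - fS) f = 0 := by
    intro f hf
    induction hf using Submodule.span_induction with
    | mem x hx =>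
      obtain ⟨j, hj, rfl⟩ := hx
      exact horth j hj
    | zero => simp
    | add x y _ _ hx hy => rw [inner_add_right, hx, hy, add_zero]
    | smul a x _ hx => rw [inner_smul_right, hx, mul_zero]
  have hmem : fS ∈ Submodule.span ℝ (g '' (S : Set (Fin m))) := by
    rw [hfS]
    exact Submodule.smul_mem _ _ (Submodule.sum_mem _ fun i hi =>
      Submodule.subset_span ⟨i, hi, rfl⟩)
  have hpyth : ∀ f ∈ Submodule.span ℝ (g '' (S : Set (Fin m))),
      ‖e 0 - f‖ ^ 2 = ‖e 0 - fS‖ ^ 2 + ‖fS - f‖ ^ 2 := by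
    intro f hf
    have h := hspan _ (Submodule.sub_mem _ hmem hf)
    have h2 : e 0 - f = (e 0 - fS) + (fS - f) := by abel
    rw [h2, norm_add_sq_real, h]
    ring
  refine ⟨hmem, ?_, ?_, ?_⟩
  · intro f hf
    rw [hpyth f hf]
    nlinarith [sq_nonneg ‖fS - f‖]
  · intro f hf h
    rw [hpyth f hf] at h
    have h3 : ‖fS - f‖ ^ 2 = 0 := by linarith
    have h4 : fS - f = 0 := norm_eq_zero.mp (pow_eq_zero_iff two_ne_zero |>.mp h3)
    exact (sub_eq_zero.mp h4).symm
  · rw [← real_inner_self_eq_norm_sq, inner_sub_right, hspan fS hmem, inner_sub_left, hee,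
      real_inner_comm, hfS, inner_smul_right, inner_sum]
    simp only [h0g]
    simp
    field_simp
    ring
end

section
/- Let E be a separable real Hilbert space, μ > 0, and let R : E → ℝ be continuous and μ-strongly convex in the sense that R((f+g)/2) ≤ (1/2)R(f) + (1/2)R(g) − (μ/8)‖f − g‖² for all f, g ∈ E (equivalently, via the midpoint anchoring inequality for strongly convex risks). Let Q be a Borel probability measure on E. For a finite tuple G = (g₁, …, g_t) ∈ E^t, let h_G denote the unique minimizer of R over the linear span of {g₁, …, g_t} (which exists and is unique by strong convexity and continuity on a finite-dimensional subspace), and let R(G) := R(h_G); assume the maps G ↦ h_G and G ↦ R(G) are measurable and that R(G) is integrable under each product measure Q^t. Let R̄_t be the expectation of R(G) over G ∼ Q^t. Then for G, G′ drawn independently from Q^k, E[‖h_G − h_{G′}‖²] ≤ (8/μ)(R̄_k − R̄_{2k}), where R̄_{2k} is the expectation of R over the concatenated 2k-tuple. -/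
open MeasureTheory

/-- Agreement for stacked aggregation with strongly convex risks: `R` is continuous and
`μ`-strongly convex (midpoint form), base models are drawn i.i.d. from `Q` on a separable
real Hilbert space `E`, and `h t G` is the risk minimizer over the span of `G`. Then
`E[‖h_G − h_{G'}‖²] ≤ (8/μ)(R̄_k − R̄_{2k})`. -/
theorem strongly_convex_stacking_agreement
    {E : Type*} [NormedAddCommGroup E] [InnerProductSpace ℝ E] [CompleteSpace E]
    [SecondCountableTopology E] [MeasurableSpace E] [BorelSpace E]
    (μ : ℝ) (hμ : 0 < μ) (R : E → ℝ) (hcont : Continuous R)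
    (hsc : ∀ f g : E,
      R ((1 / 2 : ℝ) • (f + g)) ≤ (1 / 2) * R f + (1 / 2) * R g - μ / 8 * ‖f - g‖ ^ 2)
    (Q : Measure E) [IsProbabilityMeasure Q]
    (h : (t : ℕ) → (Fin t → E) → E)
    (hmin : ∀ (t : ℕ) (G : Fin t → E),
      h t G ∈ Submodule.span ℝ (Set.range G) ∧
        ∀ f ∈ Submodule.span ℝ (Set.range G), R (h t G) ≤ R f)
    (hmeas : ∀ t : ℕ, Measurable (h t))
    (hint : ∀ t : ℕ,
      Integrable (fun G : Fin t → E => R (h t G)) (Measure.pi fun _ : Fin t => Q))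
    (k : ℕ) :
    (∫ p : (Fin k → E) × (Fin k → E), ‖h k p.1 - h k p.2‖ ^ 2
        ∂((Measure.pi fun _ : Fin k => Q).prod (Measure.pi fun _ : Fin k => Q))) ≤
      8 / μ * ((∫ G, R (h k G) ∂(Measure.pi fun _ : Fin k => Q))
            - ∫ G, R (h (2 * k) G) ∂(Measure.pi fun _ : Fin (2 * k) => Q)) := by
  set P := Measure.pi fun _ : Fin k => Q with hP
  let e : Fin k ⊕ Fin k ≃ Fin (2 * k) := finSumFinEquiv.trans (finCongr (two_mul k).symm)
  let A := MeasurableEquiv.sumPiEquivProdPi (fun _ : Fin k ⊕ Fin k => E)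
  let B := MeasurableEquiv.piCongrLeft (fun _ : Fin (2 * k) => E) e
  have hA : MeasurePreserving A.symm (P.prod P) (Measure.pi fun _ : Fin k ⊕ Fin k => Q) :=
    measurePreserving_sumPiEquivProdPi_symm (fun _ : Fin k ⊕ Fin k => Q)
  have hB : MeasurePreserving B (Measure.pi fun _ : Fin k ⊕ Fin k => Q)
      (Measure.pi fun _ : Fin (2 * k) => Q) :=
    measurePreserving_piCongrLeft (fun _ : Fin (2 * k) => Q) e
  have hC : MeasurePreserving (fun p => B (A.symm p)) (P.prod P)
      (Measure.pi fun _ : Fin (2 * k) => Q) := hB.comp hA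
  have hBe : ∀ (x : Fin k ⊕ Fin k → E) i, B x (e i) = x i := fun x i =>
    MeasurableEquiv.piCongrLeft_apply_apply (β := fun _ : Fin (2 * k) => E) e x i
  have hl : ∀ p : (Fin k → E) × (Fin k → E), Set.range p.1 ⊆ Set.range (B (A.symm p)) := by
    rintro p _ ⟨i, rfl⟩
    exact ⟨e (Sum.inl i), hBe _ _⟩
  have hr : ∀ p : (Fin k → E) × (Fin k → E), Set.range p.2 ⊆ Set.range (B (A.symm p)) := by
    rintro p _ ⟨i, rfl⟩
    exact ⟨e (Sum.inr i), hBe _ _⟩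
  have key : ∀ p : (Fin k → E) × (Fin k → E), ‖h k p.1 - h k p.2‖ ^ 2 ≤
      8 / μ * ((1 / 2) * R (h k p.1) + (1 / 2) * R (h k p.2)
        - R (h (2 * k) (B (A.symm p)))) := by
    intro p
    have h1 := hsc (h k p.1) (h k p.2)
    have h2 := (hmin (2 * k) (B (A.symm p))).2 ((1 / 2 : ℝ) • (h k p.1 + h k p.2))
      (Submodule.smul_mem _ _ (Submodule.add_mem _
        (Submodule.span_mono (hl p) (hmin k p.1).1) (Submodule.span_mono (hr p) (hmin k p.2).1)))
    rw [div_mul_eq_mul_div, le_div_iff₀ hμ]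
    linarith
  have i1 : Integrable (fun p : (Fin k → E) × (Fin k → E) => R (h k p.1)) (P.prod P) :=
    (hint k).comp_fst P
  have i2 : Integrable (fun p : (Fin k → E) × (Fin k → E) => R (h k p.2)) (P.prod P) :=
    (hint k).comp_snd P
  have i3 : Integrable (fun p : (Fin k → E) × (Fin k → E) => R (h (2 * k) (B (A.symm p))))
      (P.prod P) := hC.integrable_comp_of_integrable (hint (2 * k))
  have e1 : ∫ p, R (h k p.1) ∂(P.prod P) = ∫ G, R (h k G) ∂P := by
    rw [integral_fun_fst (fun G => R (h k G))]; simp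
  have e2 : ∫ p, R (h k p.2) ∂(P.prod P) = ∫ G, R (h k G) ∂P := by
    rw [integral_fun_snd (fun G => R (h k G))]; simp
  have e3 : ∫ p, R (h (2 * k) (B (A.symm p))) ∂(P.prod P) =
      ∫ G, R (h (2 * k) G) ∂(Measure.pi fun _ : Fin (2 * k) => Q) :=
    hC.integral_comp (A.symm.trans B).measurableEmbedding (fun G => R (h (2 * k) G))
  refine (integral_mono_of_nonneg (Filter.Eventually.of_forall fun p => by positivity)
    ((((i1.const_mul (1 / 2)).add (i2.const_mul (1 / 2))).sub i3).const_mul (8 / μ))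
    (Filter.Eventually.of_forall key)).trans (le_of_eq ?_)
  rw [integral_const_mul]
  congr 1
  have s1 := integral_sub ((i1.const_mul (1 / 2)).add (i2.const_mul (1 / 2))) i3
  have s2 := integral_add (i1.const_mul (1 / 2)) (i2.const_mul (1 / 2))
  rw [integral_const_mul, integral_const_mul, e1, e2] at s2
  rw [e3] at s1
  simp only [Pi.add_apply] at s1
  refine s1.trans ?_
  rw [s2]
  ring
end

section
/- Let E be a real Hilbert space and let F : E → ℝ be differentiable and convex, i.e. F(z) ≥ F(f) + ⟨∇F(f), z − f⟩ for all f, z ∈ E. Let C ⊆ E be nonempty with g ∈ C ⟹ −g ∈ C and ‖g‖ ≤ 1 for all g ∈ C, let τ > 0, and let K_τ := τ · convexHull(C). Then for every f ∈ K_τ, sup_{g∈C} |⟨∇F(f), g⟩| ≥ (F(f) − inf_{z∈K_τ} F(z)) / (2τ). -/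
open scoped Pointwise

/-- Frank–Wolfe correlation lower bound w.r.t. the weak-learning anchor gap: for a
differentiable convex risk `F`, a symmetric normalized weak-learner class `C`, and
`K_τ = τ · conv C`, every `f ∈ K_τ` satisfies
`sup_{g∈C} |⟨∇F(f), g⟩| ≥ (F(f) − inf_{z∈K_τ} F(z)) / (2τ)`. -/
theorem frank_wolfe_correlation_lower_bound
    {E : Type*} [NormedAddCommGroup E] [InnerProductSpace ℝ E] [CompleteSpace E]
    (F : E → ℝ) (hdiff : Differentiable ℝ F)
    (hconv : ∀ f z : E, F z ≥ F f + fderiv ℝ F f (z - f))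
    (C : Set E) (hC : C.Nonempty)
    (hsym : ∀ g ∈ C, -g ∈ C) (hnorm : ∀ g ∈ C, ‖g‖ ≤ 1)
    (τ : ℝ) (hτ : 0 < τ) :
    ∀ f ∈ τ • convexHull ℝ C,
      (F f - sInf (F '' (τ • convexHull ℝ C))) / (2 * τ) ≤
        sSup ((fun g => |fderiv ℝ F f g|) '' C) := by
  intro f hf
  set L := fderiv ℝ F f with hL
  set M := sSup ((fun g => |L g|) '' C) with hM
  have hbdd : BddAbove ((fun g => |L g|) '' C) := by
    refine ⟨‖L‖, ?_⟩
    rintro _ ⟨g, hg, rfl⟩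
    have h1 : ‖L g‖ ≤ ‖L‖ * ‖g‖ := L.le_opNorm g
    have h2 : ‖L‖ * ‖g‖ ≤ ‖L‖ * 1 :=
      mul_le_mul_of_nonneg_left (hnorm g hg) (norm_nonneg _)
    rw [Real.norm_eq_abs] at h1
    simp only
    linarith
  have hconvSet : Convex ℝ ((L : E →ₗ[ℝ] ℝ) ⁻¹' Set.Icc (-M) M) :=
    (convex_Icc (-M) M).linear_preimage _
  have hsub : convexHull ℝ C ⊆ (L : E →ₗ[ℝ] ℝ) ⁻¹' Set.Icc (-M) M := by
    refine convexHull_min ?_ hconvSet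
    intro g hg
    exact abs_le.mp (le_csSup hbdd ⟨g, hg, rfl⟩)
  have hK : ∀ z ∈ τ • convexHull ℝ C, -(τ * M) ≤ L z ∧ L z ≤ τ * M := by
    rintro _ ⟨h, hh, rfl⟩
    have h1 : -M ≤ L h ∧ L h ≤ M := hsub hh
    simp only [map_smul, smul_eq_mul]
    constructor <;> nlinarith [h1.1, h1.2]
  have hinf : F f - 2 * τ * M ≤ sInf (F '' (τ • convexHull ℝ C)) := by
    refine le_csInf ⟨F f, f, hf, rfl⟩ ?_
    rintro _ ⟨z, hz, rfl⟩
    have h1 := hconv f z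
    rw [← hL, map_sub] at h1
    linarith [(hK z hz).1, (hK f hf).2]
  rw [div_le_iff₀ (by positivity)]
  linarith
end

section
/- Let E be a real Hilbert space, L > 0, μ... (not needed here), τ > 0, and let F : E → ℝ be differentiable, convex (F(z) ≥ F(f) + ⟨∇F(f), z − f⟩ for all f, z), and L-smooth (F(b) ≤ F(a) + ⟨∇F(a), b − a⟩ + (L/2)‖b − a‖² for all a, b). Let K_τ ⊆ E be a nonempty convex set with ‖s‖ ≤ τ for all s ∈ K_τ, and assume inf_{z∈K_τ} F(z) > −∞. Let (ε_t)_{t≥1} be nonnegative, set f₀ := 0 and for t ≥ 1 let α_t := 2/(t+1), let g_t ∈ K_τ satisfy ⟨−∇F(f_{t−1}), g_t⟩ ≥ sup_{s∈K_τ} ⟨−∇F(f_{t−1}), s⟩ − τ ε_t, and f_t := f_{t−1} + α_t (g_t − f_{t−1}). Define E_t := F(f_t) − inf_{z∈K_τ} F(z). Then for every t ≥ 1, E_{t−1} − E_t ≥ α_t (E_{t−1} − τ ε_t) − 2Lτ² α_t². -/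
/-- Frank–Wolfe gap recurrence: `F` is differentiable, convex and `L`-smooth, `K_τ` is a
nonempty convex feasible set with norms at most `τ` and `inf_{K_τ} F > −∞`. The iterates
start at `f₀ = 0` with step sizes `α_t = 2/(t+1)` and a `τε_t`-approximate linear
minimization oracle. Then the gaps `E_t := F(f_t) − inf_{K_τ} F` satisfy
`E_{t−1} − E_t ≥ α_t (E_{t−1} − τ ε_t) − 2Lτ²α_t²`. (Index shift: step `t+1` plays the
role of step `t ≥ 1`, with `α_{t+1} = 2/(t+2)`.) -/
theorem frank_wolfe_gap_recurrence
    {E : Type*} [NormedAddCommGroup E] [InnerProductSpace ℝ E] [CompleteSpace E]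
    (L τ : ℝ) (hL : 0 < L) (hτ : 0 < τ)
    (F : E → ℝ) (hdiff : Differentiable ℝ F)
    (hconv : ∀ f z : E, F z ≥ F f + fderiv ℝ F f (z - f))
    (hsmooth : ∀ a b : E, F b ≤ F a + fderiv ℝ F a (b - a) + L / 2 * ‖b - a‖ ^ 2)
    (K : Set E) (hK : K.Nonempty) (hKconv : Convex ℝ K) (hKτ : ∀ s ∈ K, ‖s‖ ≤ τ)
    (hFbdd : BddBelow (F '' K))
    (ε : ℕ → ℝ) (hε : ∀ t, 0 ≤ ε t)
    (f g : ℕ → E) (hf0 : f 0 = 0)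
    (hgK : ∀ t : ℕ, g (t + 1) ∈ K)
    (horacle : ∀ t : ℕ,
      -(fderiv ℝ F (f t) (g (t + 1))) ≥
        sSup ((fun s => -(fderiv ℝ F (f t) s)) '' K) - τ * ε (t + 1))
    (hstep : ∀ t : ℕ,
      f (t + 1) = f t + (2 / ((t : ℝ) + 2)) • (g (t + 1) - f t)) :
    ∀ t : ℕ,
      (F (f t) - sInf (F '' K)) - (F (f (t + 1)) - sInf (F '' K)) ≥
        (2 / ((t : ℝ) + 2)) * ((F (f t) - sInf (F '' K)) - τ * ε (t + 1))
          - 2 * L * τ ^ 2 * (2 / ((t : ℝ) + 2)) ^ 2 := by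
  have hα0 : ∀ t : ℕ, 0 ≤ 2 / ((t : ℝ) + 2) := fun t => by positivity
  have hα1 : ∀ t : ℕ, 2 / ((t : ℝ) + 2) ≤ 1 := fun t => by
    rw [div_le_one (by positivity)]
    have : (0 : ℝ) ≤ t := Nat.cast_nonneg t
    linarith
  have hfτ : ∀ t : ℕ, ‖f t‖ ≤ τ := by
    intro t
    induction t with
    | zero => simpa [hf0] using hτ.le
    | succ n ih =>
      have h := (convex_closedBall (0 : E) τ).add_smul_sub_mem
        (mem_closedBall_zero_iff.2 ih) (mem_closedBall_zero_iff.2 (hKτ _ (hgK n)))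
        ⟨hα0 n, hα1 n⟩
      rw [hstep n]
      exact mem_closedBall_zero_iff.1 h
  intro t
  have ha := hα0 t
  have hst := hstep t
  generalize 2 / ((t : ℝ) + 2) = α at ha hst ⊢
  have hb : BddAbove ((fun s => -(fderiv ℝ F (f t) s)) '' K) := by
    refine ⟨‖fderiv ℝ F (f t)‖ * τ, ?_⟩
    rintro _ ⟨s, hs, rfl⟩
    have h1 := (fderiv ℝ F (f t)).le_opNorm s
    have h2 := mul_le_mul_of_nonneg_left (hKτ s hs) (norm_nonneg (fderiv ℝ F (f t)))
    have h3 := neg_le_abs (fderiv ℝ F (f t) s)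
    rw [Real.norm_eq_abs] at h1
    exact h3.trans (h1.trans h2)
  have hinf : F (f t) + fderiv ℝ F (f t) (g (t + 1) - f t) - τ * ε (t + 1)
      ≤ sInf (F '' K) := by
    apply le_csInf (hK.image F)
    rintro _ ⟨z, hz, rfl⟩
    have h1 := hconv (f t) z
    have h2 : -(fderiv ℝ F (f t) z) ≤ _ := le_csSup hb ⟨z, hz, rfl⟩
    have h3 := horacle t
    rw [map_sub] at h1 ⊢
    linarith
  have hs := hsmooth (f t) (f (t + 1))
  have hd : f (t + 1) - f t = α • (g (t + 1) - f t) := by rw [hst]; abel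
  rw [hd, map_smul, norm_smul, smul_eq_mul, Real.norm_eq_abs, mul_pow, sq_abs] at hs
  have hn : ‖g (t + 1) - f t‖ ≤ 2 * τ := by
    have := norm_sub_le (g (t + 1)) (f t)
    linarith [hfτ t, hKτ _ (hgK t)]
  have hn2 : ‖g (t + 1) - f t‖ ^ 2 ≤ (2 * τ) ^ 2 := by gcongr
  have h4 : L / 2 * (α ^ 2 * ‖g (t + 1) - f t‖ ^ 2) ≤ L / 2 * (α ^ 2 * (2 * τ) ^ 2) := by
    gcongr
  have h5 := mul_le_mul_of_nonneg_left hinf ha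
  linarith
end

section
/- Let τ > 0, L > 0, let (ε_t)_{t≥1} be a sequence of nonnegative reals, and let (E_t)_{t≥0} be a sequence of reals satisfying, for all t ≥ 1, E_t ≤ ((t−1)/(t+1)) E_{t−1} + 8Lτ²/(t+1)² + (2τ/(t+1)) ε_t. Then for all t ≥ 1, E_t ≤ 8Lτ²/(t+1) + (2τ/(t+1)) Σ_{j=1}^{t} ε_j. -/
/-- Frank–Wolfe sequence lemma: if `E_t ≤ ((t−1)/(t+1)) E_{t−1} + 8Lτ²/(t+1)² +
(2τ/(t+1)) ε_t` for all `t ≥ 1` (stated with the index shift `t ↦ t+1`), then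
`E_t ≤ 8Lτ²/(t+1) + (2τ/(t+1)) ∑_{j=1}^t ε_j` for all `t ≥ 1`. -/
theorem frank_wolfe_sequence_lemma
    (τ L : ℝ) (hτ : 0 < τ) (hL : 0 < L)
    (ε : ℕ → ℝ) (hε : ∀ t, 0 ≤ ε t)
    (E : ℕ → ℝ)
    (hrec : ∀ t : ℕ,
      E (t + 1) ≤ ((t : ℝ) / ((t : ℝ) + 2)) * E t
        + 8 * L * τ ^ 2 / ((t : ℝ) + 2) ^ 2
        + (2 * τ / ((t : ℝ) + 2)) * ε (t + 1)) :
    ∀ t : ℕ, 1 ≤ t →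
      E t ≤ 8 * L * τ ^ 2 / ((t : ℝ) + 1)
        + (2 * τ / ((t : ℝ) + 1)) * ∑ j ∈ Finset.Icc 1 t, ε j := by
  intro t ht
  induction t, ht using Nat.le_induction with
  | base =>
    have h := hrec 0
    have hp : 0 < L * τ ^ 2 := by positivity
    norm_num at h ⊢
    linarith
  | succ t ht ih =>
    have h := hrec t
    rw [Finset.sum_Icc_succ_top (by omega)]
    have hS : 0 ≤ ∑ j ∈ Finset.Icc 1 t, ε j := Finset.sum_nonneg fun j _ => hε j
    generalize (∑ j ∈ Finset.Icc 1 t, ε j) = S at *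
    push_cast
    have hx : (0 : ℝ) ≤ t := Nat.cast_nonneg t
    generalize (t : ℝ) = x at *
    have h2 := mul_le_mul_of_nonneg_left ih (show 0 ≤ x / (x + 2) by positivity)
    refine h.trans ?_
    have key : 8 * L * τ ^ 2 / (x + 1 + 1) + 2 * τ / (x + 1 + 1) * (S + ε (t + 1))
        - (x / (x + 2) * (8 * L * τ ^ 2 / (x + 1) + 2 * τ / (x + 1) * S)
          + 8 * L * τ ^ 2 / (x + 2) ^ 2 + 2 * τ / (x + 2) * ε (t + 1))
        = 8 * L * τ ^ 2 / ((x + 1) * (x + 2) ^ 2) + 2 * τ * S / ((x + 1) * (x + 2)) := by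
      rw [show x + 1 + 1 = x + 2 by ring]
      field_simp
      ring
    have hpos : 0 ≤ 8 * L * τ ^ 2 / ((x + 1) * (x + 2) ^ 2)
        + 2 * τ * S / ((x + 1) * (x + 2)) := by positivity
    linarith
end

section
/- Let E be a real Hilbert space, μ > 0, L > 0, τ > 0, and let F : E → ℝ be differentiable, μ-strongly convex (F(p) ≥ F(q) + ⟨∇F(q), p − q⟩ + (μ/2)‖p − q‖² for all p, q ∈ E) and L-smooth (F(b) ≤ F(a) + ⟨∇F(a), b − a⟩ + (L/2)‖b − a‖² for all a, b ∈ E). Let K_τ ⊆ E be a nonempty convex set with ‖s‖ ≤ τ for all s ∈ K_τ. Let k ≥ 1 and let (f_t)_{t=0}^{k} and (f′_t)_{t=0}^{k} be two Frank–Wolfe runs with nonnegative oracle error sequences (ε_t)_{t=1}^{k} and (ε′_t)_{t=1}^{k}: f₀ = f′₀ = 0, and for t = 1, …, k, with α_t = 2/(t+1), g_t ∈ K_τ satisfies ⟨−∇F(f_{t−1}), g_t⟩ ≥ sup_{s∈K_τ} ⟨−∇F(f_{t−1}), s⟩ − τ ε_t and f_t = f_{t−1} + α_t (g_t − f_{t−1})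 (analogously for the primed run with errors ε′_t). Then ‖f_k − f′_k‖² ≤ 64Lτ²/(μ(k+1)) + (8τ/(μ(k+1))) (Σ_{j=1}^{k} ε_j + Σ_{j=1}^{k} ε′_j). -/
theorem fw_gap_aux
    {E : Type*} [NormedAddCommGroup E] [InnerProductSpace ℝ E]
    (μ L τ : ℝ) (hμ : 0 < μ) (hL : 0 < L) (hτ : 0 < τ)
    (F : E → ℝ)
    (hsc : ∀ p q : E, F p ≥ F q + fderiv ℝ F q (p - q) + μ / 2 * ‖p - q‖ ^ 2)
    (hsmooth : ∀ a b : E, F b ≤ F a + fderiv ℝ F a (b - a) + L / 2 * ‖b - a‖ ^ 2)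
    (K : Set E) (hKconv : Convex ℝ K) (hKτ : ∀ s ∈ K, ‖s‖ ≤ τ)
    (ε : ℕ → ℝ) (hε : ∀ t, 0 ≤ ε t)
    (f g : ℕ → E) (hf0 : f 0 = 0)
    (hgK : ∀ t : ℕ, g (t + 1) ∈ K)
    (horacle : ∀ t : ℕ,
      -(fderiv ℝ F (f t) (g (t + 1))) ≥
        sSup ((fun s => -(fderiv ℝ F (f t) s)) '' K) - τ * ε (t + 1))
    (hstep : ∀ t : ℕ,
      f (t + 1) = f t + (2 / ((t : ℝ) + 2)) • (g (t + 1) - f t)) :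
    (∀ t, f (t + 1) ∈ K) ∧ ∀ u ∈ K, ∀ k : ℕ,
      (k : ℝ) * (k + 1) * (F (f k) - F u) ≤
        8 * L * τ ^ 2 * k + 2 * k * τ * ∑ j ∈ Finset.Icc 1 k, ε j := by
  have hmem : ∀ t, f (t + 1) ∈ K := by
    intro t
    induction t with
    | zero =>
      have h := hstep 0
      rw [hf0] at h
      norm_num at h
      rw [zero_add, h]
      exact hgK 0
    | succ n ih =>
      rw [hstep (n + 1)]
      have hpos : (0 : ℝ) < ((n + 1 : ℕ) : ℝ) + 2 := by positivity
      apply hKconv.add_smul_sub_mem ih (hgK (n + 1))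
      refine ⟨by positivity, ?_⟩
      rw [div_le_one hpos]
      have : (0 : ℝ) ≤ ((n + 1 : ℕ) : ℝ) := by positivity
      linarith
  have hnorm : ∀ t, ‖f t‖ ≤ τ := by
    intro t
    cases t with
    | zero => rw [hf0, norm_zero]; exact hτ.le
    | succ n => exact hKτ _ (hmem n)
  refine ⟨hmem, ?_⟩
  intro u hu k
  induction k with
  | zero => simp
  | succ n ih =>
    have hbdd : BddAbove ((fun s => -(fderiv ℝ F (f n) s)) '' K) := by
      refine ⟨‖fderiv ℝ F (f n)‖ * τ, ?_⟩
      rintro _ ⟨s, hs, rfl⟩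
      have h1 := (fderiv ℝ F (f n)).le_opNorm s
      have h2 := neg_le_abs (fderiv ℝ F (f n) s)
      rw [Real.norm_eq_abs] at h1
      have h3 := mul_le_mul_of_nonneg_left (hKτ s hs) (norm_nonneg (fderiv ℝ F (f n)))
      show -(fderiv ℝ F (f n) s) ≤ _
      linarith
    have hsup : -(fderiv ℝ F (f n) u) ≤ sSup ((fun s => -(fderiv ℝ F (f n) s)) '' K) :=
      le_csSup hbdd ⟨u, hu, rfl⟩
    have ho := horacle n
    have hc := hsc u (f n)
    have hs := hsmooth (f n) (f (n + 1))
    have hd : f (n + 1) - f n = (2 / ((n : ℝ) + 2)) • (g (n + 1) - f n) := by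
      rw [hstep n]; abel
    rw [hd, norm_smul, map_smul, smul_eq_mul, map_sub, mul_pow, Real.norm_eq_abs, sq_abs] at hs
    rw [map_sub] at hc
    have hn0 : (0 : ℝ) ≤ n := Nat.cast_nonneg n
    have hg2 : ‖g (n + 1) - f n‖ ^ 2 ≤ 4 * τ ^ 2 := by
      have h1 := norm_sub_le (g (n + 1)) (f n)
      have h2 := hKτ _ (hgK n)
      have h3 := hnorm n
      have h4 : ‖g (n + 1) - f n‖ ≤ 2 * τ := by linarith
      have := pow_le_pow_left₀ (norm_nonneg _) h4 2
      linarith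
    have hpos : 0 ≤ μ / 2 * ‖u - f n‖ ^ 2 := by positivity
    have hα : (0 : ℝ) ≤ 2 / ((n : ℝ) + 2) := by positivity
    set A := fderiv ℝ F (f n) (g (n + 1)) - fderiv ℝ F (f n) (f n) with hA
    have hA1 : A ≤ F u - F (f n) + τ * ε (n + 1) := by linarith
    have hA2 := mul_le_mul_of_nonneg_left hA1 hα
    have hq : L / 2 * ((2 / ((n : ℝ) + 2)) ^ 2 * ‖g (n + 1) - f n‖ ^ 2) ≤
        L / 2 * ((2 / ((n : ℝ) + 2)) ^ 2 * (4 * τ ^ 2)) := by gcongr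
    have hfin : F (f (n + 1)) - F u ≤ (F (f n) - F u) +
        2 / ((n : ℝ) + 2) * (F u - F (f n) + τ * ε (n + 1)) +
        L / 2 * ((2 / ((n : ℝ) + 2)) ^ 2 * (4 * τ ^ 2)) := by linarith
    have hw : (0 : ℝ) ≤ ((n : ℝ) + 1) * (n + 2) := by positivity
    have hm := mul_le_mul_of_nonneg_left hfin hw
    have he : ((n : ℝ) + 1) * (n + 2) * ((F (f n) - F u) +
        2 / ((n : ℝ) + 2) * (F u - F (f n) + τ * ε (n + 1)) +
        L / 2 * ((2 / ((n : ℝ) + 2)) ^ 2 * (4 * τ ^ 2))) =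
        n * (n + 1) * (F (f n) - F u) + 2 * (n + 1) * τ * ε (n + 1)
          + 8 * L * τ ^ 2 * ((n + 1) / (n + 2)) := by
      field_simp
      ring
    have hr : ((n : ℝ) + 1) / (n + 2) ≤ 1 := by
      rw [div_le_one (by positivity)]; linarith
    have hr2 := mul_le_mul_of_nonneg_left hr (by positivity : 0 ≤ 8 * L * τ ^ 2)
    have hS : 0 ≤ τ * ∑ j ∈ Finset.Icc 1 n, ε j :=
      mul_nonneg hτ.le (Finset.sum_nonneg fun j _ => hε j)
    rw [Finset.sum_Icc_succ_top (by omega)]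
    push_cast
    rw [he] at hm
    have e1 : ((n : ℝ) + 1) * (n + 1 + 1) = (n + 1) * (n + 2) := by ring
    rw [e1]
    linarith

/-- Frank–Wolfe gradient boosting agreement bound: `F` is differentiable, `μ`-strongly
convex and `L`-smooth, `K_τ` is a nonempty convex feasible set of norm at most `τ`, and
two Frank–Wolfe runs (step sizes `α_t = 2/(t+1)`, oracle errors `ε`, `ε'`) start at `0`.
Then after `k ≥ 1` iterations,
`‖f_k − f'_k‖² ≤ 64Lτ²/(μ(k+1)) + (8τ/(μ(k+1)))(∑ε_j + ∑ε'_j)`. -/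
theorem frank_wolfe_agreement_bound
    {E : Type*} [NormedAddCommGroup E] [InnerProductSpace ℝ E] [CompleteSpace E]
    (μ L τ : ℝ) (hμ : 0 < μ) (hL : 0 < L) (hτ : 0 < τ)
    (F : E → ℝ) (hdiff : Differentiable ℝ F)
    (hsc : ∀ p q : E, F p ≥ F q + fderiv ℝ F q (p - q) + μ / 2 * ‖p - q‖ ^ 2)
    (hsmooth : ∀ a b : E, F b ≤ F a + fderiv ℝ F a (b - a) + L / 2 * ‖b - a‖ ^ 2)
    (K : Set E) (hK : K.Nonempty) (hKconv : Convex ℝ K) (hKτ : ∀ s ∈ K, ‖s‖ ≤ τ)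
    (k : ℕ) (hk : 1 ≤ k)
    (ε ε' : ℕ → ℝ) (hε : ∀ t, 0 ≤ ε t) (hε' : ∀ t, 0 ≤ ε' t)
    (f g f' g' : ℕ → E) (hf0 : f 0 = 0) (hf'0 : f' 0 = 0)
    (hgK : ∀ t : ℕ, g (t + 1) ∈ K) (hg'K : ∀ t : ℕ, g' (t + 1) ∈ K)
    (horacle : ∀ t : ℕ,
      -(fderiv ℝ F (f t) (g (t + 1))) ≥
        sSup ((fun s => -(fderiv ℝ F (f t) s)) '' K) - τ * ε (t + 1))
    (horacle' : ∀ t : ℕ,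
      -(fderiv ℝ F (f' t) (g' (t + 1))) ≥
        sSup ((fun s => -(fderiv ℝ F (f' t) s)) '' K) - τ * ε' (t + 1))
    (hstep : ∀ t : ℕ,
      f (t + 1) = f t + (2 / ((t : ℝ) + 2)) • (g (t + 1) - f t))
    (hstep' : ∀ t : ℕ,
      f' (t + 1) = f' t + (2 / ((t : ℝ) + 2)) • (g' (t + 1) - f' t)) :
    ‖f k - f' k‖ ^ 2 ≤
      64 * L * τ ^ 2 / (μ * ((k : ℝ) + 1))
        + (8 * τ / (μ * ((k : ℝ) + 1)))
            * ((∑ j ∈ Finset.Icc 1 k, ε j) + ∑ j ∈ Finset.Icc 1 k, ε' j) := by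
  obtain ⟨hm, hgap⟩ := fw_gap_aux μ L τ hμ hL hτ F hsc hsmooth K hKconv hKτ ε hε f g hf0 hgK
    horacle hstep
  obtain ⟨hm', hgap'⟩ := fw_gap_aux μ L τ hμ hL hτ F hsc hsmooth K hKconv hKτ ε' hε' f' g' hf'0
    hg'K horacle' hstep'
  obtain ⟨n, rfl⟩ : ∃ n, k = n + 1 := ⟨k - 1, by omega⟩
  have hu : midpoint ℝ (f (n + 1)) (f' (n + 1)) ∈ K := hKconv.midpoint_mem (hm n) (hm' n)
  have h1 := hgap _ hu (n + 1)
  have h2 := hgap' _ hu (n + 1)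
  have s1 := hsc (f (n + 1)) (midpoint ℝ (f (n + 1)) (f' (n + 1)))
  have s2 := hsc (f' (n + 1)) (midpoint ℝ (f (n + 1)) (f' (n + 1)))
  have d1 : f (n + 1) - midpoint ℝ (f (n + 1)) (f' (n + 1)) =
      (1 / 2 : ℝ) • (f (n + 1) - f' (n + 1)) := by
    rw [midpoint_eq_smul_add, invOf_eq_inv]; module
  have d2 : f' (n + 1) - midpoint ℝ (f (n + 1)) (f' (n + 1)) =
      (-(1 / 2) : ℝ) • (f (n + 1) - f' (n + 1)) := by
    rw [midpoint_eq_smul_add, invOf_eq_inv]; module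
  rw [d1, map_smul, norm_smul, mul_pow, Real.norm_eq_abs, sq_abs, smul_eq_mul] at s1
  rw [d2, map_smul, norm_smul, mul_pow, Real.norm_eq_abs, sq_abs, smul_eq_mul] at s2
  generalize midpoint ℝ (f (n + 1)) (f' (n + 1)) = u at *
  have hk0 : (0 : ℝ) < ((n + 1 : ℕ) : ℝ) := by positivity
  generalize ((n + 1 : ℕ) : ℝ) = κ at *
  generalize (∑ j ∈ Finset.Icc 1 (n + 1), ε j) = S at *
  generalize (∑ j ∈ Finset.Icc 1 (n + 1), ε' j) = S' at *
  have g1 : (κ + 1) * (F (f (n + 1)) - F u) ≤ 8 * L * τ ^ 2 + 2 * τ * S := by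
    refine le_of_mul_le_mul_left ?_ hk0
    linarith
  have g2 : (κ + 1) * (F (f' (n + 1)) - F u) ≤ 8 * L * τ ^ 2 + 2 * τ * S' := by
    refine le_of_mul_le_mul_left ?_ hk0
    linarith
  have hs : μ / 4 * ‖f (n + 1) - f' (n + 1)‖ ^ 2 ≤
      (F (f (n + 1)) - F u) + (F (f' (n + 1)) - F u) := by linarith
  have hs2 := mul_le_mul_of_nonneg_left hs (by positivity : 0 ≤ κ + 1)
  have e : 64 * L * τ ^ 2 / (μ * (κ + 1)) + (8 * τ / (μ * (κ + 1))) * (S + S') =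
      (64 * L * τ ^ 2 + 8 * τ * (S + S')) / (μ * (κ + 1)) := by ring
  rw [e, le_div_iff₀ (by positivity)]
  linarith
end
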